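/- arXiv:1912.12908 — 2 statements merged into one kernel-verified Lean document; each statement's English description precedes it below -/
import Mathlib

section
/- Let ε ∈ (0, 1) and let η be any Borel probability measure with full support on Δ, and define the perturbation function φ(τ) = (1 − ε)δ_τ + εη. Then every large game has a symmetric randomized strategy profile h : I → Δ such that for every i ∈ I, h(i) = (1 − ε)μ_i + εν for some μ_i ∈ argmax_{μ ∈ Δ} u_i(μ, φ(s(h))), where ν ∈ Δ is the uniform distribution on A (weight 1/K on each action). In particular, h is a symmetric ε-robust perfect equilibrium with perturbed player space equal to all of I. -/
open MeasureTheory Filter Topology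

section RobustPerfect

variable {I : Type*} [MeasurableSpace I] {A : Type*} [Fintype A]

/-- The societal summary of a randomized strategy profile. -/
noncomputable def socSum (lam : Measure I) (h : I → A → ℝ) : A → ℝ :=
  fun a => ∫ i, h i a ∂lam

/-- `h` is a randomized strategy profile: a measurable map into the simplex. -/
def IsProfile (lam : Measure I) (h : I → A → ℝ) : Prop :=
  Measurable h ∧ ∀ i, h i ∈ stdSimplex ℝ A

/-- A large game: payoffs continuous on the simplex and measurable in the player. -/
def IsLargeGame (u : I → A → (A → ℝ) → ℝ) : Prop :=
  (∀ i a, ContinuousOn (u i a) (stdSimplex ℝ A)) ∧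
  (∀ (a : A) (τ : A → ℝ), τ ∈ stdSimplex ℝ A → Measurable fun i => u i a τ)

/-- An atomless measure. -/
def MeasAtomless (lam : Measure I) : Prop :=
  ∀ s : Set I, MeasurableSet s → 0 < lam s →
    ∃ t : Set I, MeasurableSet t ∧ t ⊆ s ∧ 0 < lam t ∧ lam t < lam s

/-- A Borel probability measure concentrated on the simplex with full support on it. -/
def FullSupportOnSimplex (η : Measure (A → ℝ)) : Prop :=
  IsProbabilityMeasure η ∧ η (stdSimplex ℝ A)ᶜ = 0 ∧
    ∀ U : Set (A → ℝ), IsOpen U → (U ∩ stdSimplex ℝ A).Nonempty → 0 < η U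

/-- A perturbation function: a Borel measurable map from the simplex to the
full-support Borel probability measures on the simplex. -/
def IsPerturbation (φ : (A → ℝ) → Measure (A → ℝ)) : Prop :=
  (∀ τ ∈ stdSimplex ℝ A, FullSupportOnSimplex (φ τ)) ∧
  ∀ f : (A → ℝ) → ℝ, Continuous f → Measurable fun τ => ∫ x, f x ∂(φ τ)

/-- Expected payoff of action `a` against a distribution over societal summaries. -/
noncomputable def payM (ui : A → (A → ℝ) → ℝ) (a : A) (ν : Measure (A → ℝ)) : ℝ :=
  ∫ τ, ui a τ ∂ν

/-- Randomized strategy Nash equilibrium. -/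
def IsNash (lam : Measure I) (u : I → A → (A → ℝ) → ℝ) (h : I → A → ℝ) : Prop :=
  IsProfile lam h ∧
  ∀ᵐ i ∂lam, ∀ μ ∈ stdSimplex ℝ A,
    ∑ a, μ a * u i a (socSum lam h) ≤ ∑ a, h i a * u i a (socSum lam h)

/-- A weakly dominated action. -/
def WeaklyDominated (ui : A → (A → ℝ) → ℝ) (a : A) : Prop :=
  ∃ μ ∈ stdSimplex ℝ A,
    (∀ τ ∈ stdSimplex ℝ A, ui a τ ≤ ∑ b, μ b * ui b τ) ∧
    (∃ τ ∈ stdSimplex ℝ A, ui a τ < ∑ b, μ b * ui b τ)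

/-- Admissibility: almost no player puts weight on a weakly dominated action. -/
def Admissible (lam : Measure I) (u : I → A → (A → ℝ) → ℝ) (h : I → A → ℝ) : Prop :=
  ∀ᵐ i ∂lam, ∀ a : A, WeaklyDominated (u i) a → h i a = 0

/-- Weak convergence of a sequence of measures to a Dirac measure. -/
def WeakTendstoDirac (ν : ℕ → Measure (A → ℝ)) (τ : A → ℝ) : Prop :=
  ∀ f : (A → ℝ) → ℝ, Continuous f →
    Tendsto (fun n => ∫ x, f x ∂(ν n)) atTop (nhds (f τ))

/-- Aggregate robustness. -/
def AggregateRobust (lam : Measure I) (u : I → A → (A → ℝ) → ℝ) (h : I → A → ℝ) : Prop :=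
  ∀ᵐ i ∂lam, ∃ φ : ℕ → (A → ℝ) → Measure (A → ℝ),
    (∀ n, IsPerturbation (φ n)) ∧
    (∀ τ ∈ stdSimplex ℝ A, WeakTendstoDirac (fun n => φ n τ) τ) ∧
    ∀ n, ∀ μ ∈ stdSimplex ℝ A,
      ∑ a, μ a * payM (u i) a (φ n (socSum lam h)) ≤
        ∑ a, h i a * payM (u i) a (φ n (socSum lam h))

/-- `ε`-robust perfect equilibrium with perturbed player space `Iε` and
perturbation function `φ`. -/
def IsEpsRPE (lam : Measure I) (u : I → A → (A → ℝ) → ℝ) (ε : ℝ)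
    (h : I → A → ℝ) (Iε : Set I) (φ : (A → ℝ) → Measure (A → ℝ)) : Prop :=
  IsProfile lam h ∧
  (∀ᵐ i ∂lam, ∀ a : A, 0 < h i a) ∧
  MeasurableSet Iε ∧ ENNReal.ofReal (1 - ε) < lam Iε ∧
  IsPerturbation φ ∧
  (∀ τ ∈ stdSimplex ℝ A, ENNReal.ofReal (1 - ε) ≤ φ τ {τ}) ∧
  ∀ i ∈ Iε, ∀ am al : A,
    payM (u i) am (φ (socSum lam h)) < payM (u i) al (φ (socSum lam h)) →
      h i am ≤ ε

/-- Robust perfect equilibrium. -/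
def IsRPE (lam : Measure I) (u : I → A → (A → ℝ) → ℝ) (h : I → A → ℝ) : Prop :=
  IsProfile lam h ∧
  ∃ (ε : ℕ → ℝ) (hs : ℕ → I → A → ℝ) (Is : ℕ → Set I)
      (φs : ℕ → (A → ℝ) → Measure (A → ℝ)),
    (∀ n, 0 < ε n) ∧ Tendsto ε atTop (nhds 0) ∧
    (∀ n, IsEpsRPE lam u (ε n) (hs n) (Is n) (φs n)) ∧
    (∀ᵐ i ∂lam, ∃ nk : ℕ → ℕ, StrictMono nk ∧ (∀ k, i ∈ Is (nk k)) ∧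
      Tendsto (fun k => hs (nk k) i) atTop (nhds (h i))) ∧
    Tendsto (fun n => socSum lam (hs n)) atTop (nhds (socSum lam h))

/-- The Dirac randomized strategy profile induced by a pure strategy profile. -/
def diracProfile [DecidableEq A] (f : I → A) : I → A → ℝ :=
  fun i a => if a = f i then 1 else 0

end RobustPerfect

/-- The perturbation function `τ ↦ (1-ε)δ_τ + ε η`. -/
noncomputable def pertOf {A : Type*} [Fintype A] (ε : ℝ) (η : Measure (A → ℝ)) :
    (A → ℝ) → Measure (A → ℝ) :=
  fun τ => ENNReal.ofReal (1 - ε) • Measure.dirac τ + ENNReal.ofReal ε • η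

/-- A set `S` is dominant for a family of rankings `r` if no point strictly beats `S` in every
ranking. -/
def IsDominant {ι V α : Type*} [LinearOrder α] (r : ι → V → α) (S : Finset V) : Prop :=
  ∀ y, ∃ i, ∀ x ∈ S, r i y ≤ r i x

namespace IsDominant

variable {ι V α : Type*} [LinearOrder α] {r : ι → V → α} {D S : Finset V}

theorem mono (hS : IsDominant r S) (hDS : D ⊆ S) : IsDominant r D := fun y =>
  (hS y).imp fun _ hi x hx => hi x (hDS hx)

/-- Adding to a dominant set `D` the best point in ranking `k` among those that beat `D` in all the
other rankings yields a dominant set. -/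
theorem insert_of_isMax [DecidableEq V] {m : ι → V} (hD : IsDominant r D) (hmD : ∀ i, m i ∈ D)
    (hm : ∀ i, ∀ x ∈ D, r i (m i) ≤ r i x) {k : ι} (hk : ∀ d ∈ D, ∃ l, l ≠ k ∧ m l = d) {y : V}
    (hy : ∀ l, l ≠ k → r l (m l) < r l y)
    (hmax : ∀ z, (∀ l, l ≠ k → r l (m l) < r l z) → r k z ≤ r k y) :
    y ∉ D ∧ IsDominant r (insert y D) := by
  constructor
  · intro hyD
    obtain ⟨l, hlk, rfl⟩ := hk y hyD
    exact lt_irrefl _ (hy l hlk)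
  · intro z
    by_cases hz : ∀ l, l ≠ k → r l (m l) < r l z
    · refine ⟨k, ?_⟩
      obtain ⟨i, hi⟩ := hD z
      have hik : i = k := by
        by_contra hne
        exact absurd (hi _ (hmD i)) (not_le.2 (hz i hne))
      subst hik
      simpa using ⟨hmax z hz, hi⟩
    · push Not at hz
      obtain ⟨l, hlk, hl⟩ := hz
      refine ⟨l, fun x hx => ?_⟩
      rcases Finset.mem_insert.1 hx with rfl | hx
      · exact hl.trans (hy l hlk).le
      · exact hl.trans (hm l x hx)

/-- A converse to `IsDominant.insert_of_isMax`. -/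
theorem exists_isMax_of_insert [DecidableEq V] (hr : ∀ i, Function.Injective (r i)) {m : ι → V}
    (hmD : ∀ i, m i ∈ D) (hm : ∀ i, ∀ x ∈ D, r i (m i) ≤ r i x) {y : V} (hyD : y ∉ D)
    (hS : IsDominant r (insert y D)) :
    ∃ k, (∀ d ∈ D, ∃ l, l ≠ k ∧ m l = d) ∧
      (Set.InjOn m {k}ᶜ → (∀ l, l ≠ k → r l (m l) < r l y) ∧
        ∀ z, (∀ l, l ≠ k → r l (m l) < r l z) → r k z ≤ r k y) := by
  obtain ⟨k, hk⟩ := hS y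
  have hne : ∀ i, m i ≠ y := fun i h => hyD (h ▸ hmD i)
  have key : ∀ d ∈ D, ∃ l, l ≠ k ∧ m l = d ∧ r l (m l) < r l y := by
    intro d hd
    obtain ⟨l, hl⟩ := hS d
    have hld : m l = d := hr l (le_antisymm (hm l d hd) (hl _ (by simp [hmD])))
    have hly : r l (m l) < r l y :=
      lt_of_le_of_ne (hld ▸ hl y (by simp)) fun h => hne l (hr l h)
    refine ⟨l, ?_, hld, hly⟩
    rintro rfl
    exact absurd (hk (m l) (by simp [hmD])) (not_le.2 hly)
  refine ⟨k, fun d hd => ?_, fun hinj => ⟨fun l hl => ?_, fun z hz => ?_⟩⟩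
  · obtain ⟨l, h1, h2, -⟩ := key d hd
    exact ⟨l, h1, h2⟩
  · obtain ⟨l', h1, h2, h3⟩ := key (m l) (hmD l)
    rwa [hinj h1 hl h2] at h3
  · obtain ⟨i, hi⟩ := hS z
    have hik : i = k := by
      by_contra hne
      exact absurd (hi (m i) (by simp [hmD])) (not_le.2 (hz i hne))
    subst hik
    exact hi y (by simp)

/-- A dominant set of codimension one that can be beaten in all but any one ranking lies in exactly
two dominant sets of full size. -/
theorem card_superset_eq_two [Fintype ι] [Fintype V] [DecidableEq V]
    (hr : ∀ i, Function.Injective (r i)) (hD : IsDominant r D) (hDne : D.Nonempty)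
    (hcard : D.card + 1 = Fintype.card ι)
    (hbeat : ∀ k, ∃ y, ∀ l, l ≠ k → ∃ x ∈ D, r l x < r l y)
    [DecidablePred fun S : Finset V => IsDominant r S ∧ S.card = Fintype.card ι ∧ D ⊆ S] :
    (Finset.univ.filter fun S : Finset V =>
      IsDominant r S ∧ S.card = Fintype.card ι ∧ D ⊆ S).card = 2 := by
  classical
  choose m hmD hm using fun i => D.exists_min_image (r i) hDne
  have hsurj : ∀ d ∈ D, ∃ l, m l = d := fun d hd => by
    obtain ⟨l, hl⟩ := hD d
    exact ⟨l, hr l (le_antisymm (hm l d hd) (hl _ (hmD l)))⟩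
  obtain ⟨i, -, j, -, hij, hmij⟩ := Finset.exists_ne_map_eq_of_card_lt_of_maps_to
    (s := Finset.univ) (t := D) (f := m) (by rw [Finset.card_univ]; omega) (fun i _ => hmD i)
  have hinj : ∀ k, (∀ d ∈ D, ∃ l, l ≠ k ∧ m l = d) → Set.InjOn m {k}ᶜ := by
    intro k hk
    have himg : (Finset.univ.erase k).image m = D := by
      ext d
      simp only [Finset.mem_image, Finset.mem_erase, Finset.mem_univ, and_true]
      exact ⟨fun ⟨l, _, h⟩ => h ▸ hmD l, hk d⟩
    have : Set.InjOn m (Finset.univ.erase k : Finset ι) := by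
      apply Finset.injOn_of_card_image_eq
      rw [himg, Finset.card_erase_of_mem (Finset.mem_univ k), Finset.card_univ]
      omega
    intro a ha b hb
    exact this (by simpa using ha) (by simpa using hb)
  have hi : ∀ d ∈ D, ∃ l, l ≠ i ∧ m l = d := by
    intro d hd
    obtain ⟨l, hl⟩ := hsurj d hd
    by_cases h : l = i
    · exact ⟨j, hij.symm, by rw [← hmij, ← h, hl]⟩
    · exact ⟨l, h, hl⟩
  have hj : ∀ d ∈ D, ∃ l, l ≠ j ∧ m l = d := by
    intro d hd
    obtain ⟨l, hl⟩ := hsurj d hd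
    by_cases h : l = j
    · exact ⟨i, hij, by rw [hmij, ← h, hl]⟩
    · exact ⟨l, h, hl⟩
  have honly : ∀ k, (∀ d ∈ D, ∃ l, l ≠ k ∧ m l = d) → k = i ∨ k = j := by
    intro k hk
    by_contra! hne
    exact hij (hinj k hk (by simpa using hne.1.symm) (by simpa using hne.2.symm) hmij)
  have hex : ∀ k, ∃ y, (∀ l, l ≠ k → r l (m l) < r l y) ∧
      ∀ z, (∀ l, l ≠ k → r l (m l) < r l z) → r k z ≤ r k y := by
    intro k
    obtain ⟨y, hy⟩ := hbeat k
    obtain ⟨z, hz, hzmax⟩ := (Finset.univ.filter fun y => ∀ l, l ≠ k → r l (m l) < r l y)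
      |>.exists_max_image (r k) ⟨y, by
        simp only [Finset.mem_filter, Finset.mem_univ, true_and]
        intro l hl
        obtain ⟨x, hx, hxy⟩ := hy l hl
        exact (hm l x hx).trans_lt hxy⟩
    simp only [Finset.mem_filter, Finset.mem_univ, true_and] at hz hzmax
    exact ⟨z, hz, hzmax⟩
  choose y hy hymax using hex
  obtain ⟨hyiD, hiS⟩ := hD.insert_of_isMax hmD hm hi (hy i) (hymax i)
  obtain ⟨hyjD, hjS⟩ := hD.insert_of_isMax hmD hm hj (hy j) (hymax j)
  have hyij : y i ≠ y j := by
    intro h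
    obtain ⟨l, hl⟩ := hD (y i)
    refine absurd (hl _ (hmD l)) (not_le.2 ?_)
    by_cases hli : l = i
    · rw [h]
      exact hy j l (hli ▸ hij)
    · exact hy i l hli
  rw [Finset.card_eq_two]
  refine ⟨insert (y i) D, insert (y j) D, fun h => ?_, ?_⟩
  · have : y i ∈ insert (y j) D := h ▸ Finset.mem_insert_self _ _
    rcases Finset.mem_insert.1 this with h | h
    · exact hyij h
    · exact hyiD h
  · ext S
    simp only [Finset.mem_filter, Finset.mem_univ, true_and, Finset.mem_insert,
      Finset.mem_singleton]
    constructor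
    · rintro ⟨hS, hSc, hDS⟩
      obtain ⟨z, hzD, rfl⟩ : ∃ z, z ∉ D ∧ insert z D = S := by
        obtain ⟨z, hz⟩ := Finset.card_eq_one.1 (show (S \ D).card = 1 by
          rw [Finset.card_sdiff_of_subset hDS]; omega)
        refine ⟨z, (Finset.mem_sdiff.1 (hz ▸ Finset.mem_singleton_self z)).2, ?_⟩
        rw [← Finset.sdiff_union_of_subset hDS, hz]
        rfl
      obtain ⟨k, hk, hkz⟩ := hS.exists_isMax_of_insert hr hmD hm hzD
      obtain ⟨hz1, hz2⟩ := hkz (hinj k hk)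
      have hzk : z = y k := hr k (le_antisymm (hymax k z hz1) (hz2 _ (hy k)))
      rcases honly k hk with rfl | rfl
      · exact Or.inl (by rw [hzk])
      · exact Or.inr (by rw [hzk])
    · rintro (rfl | rfl)
      · exact ⟨hiS, by rw [Finset.card_insert_of_notMem hyiD, hcard], Finset.subset_insert _ _⟩
      · exact ⟨hjS, by rw [Finset.card_insert_of_notMem hyjD, hcard], Finset.subset_insert _ _⟩

end IsDominant

/-- In a set of full size that misses some color, the points whose removal leaves exactly the colors
other than `i₀` are even in number. -/
theorem even_card_filter_image_erase {ι V : Type*} [Fintype ι] [DecidableEq ι] [DecidableEq V]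
    (c : V → ι) (i₀ : ι) {S : Finset V} (hcard : S.card = Fintype.card ι)
    (hS : S.image c ≠ Finset.univ) :
    Even (S.filter fun x => (S.erase x).image c = Finset.univ.erase i₀).card := by
  rcases (S.filter fun x => (S.erase x).image c = Finset.univ.erase i₀).eq_empty_or_nonempty
    with h | ⟨x, hx⟩
  · simp [h]
  obtain ⟨hxS, hx⟩ := Finset.mem_filter.1 hx
  have hcx : c x ≠ i₀ := by
    intro h
    apply hS
    rw [← Finset.insert_erase hxS, Finset.image_insert, hx, h]
    simp
  have hinj : Set.InjOn c (S.erase x) := by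
    apply Finset.injOn_of_card_image_eq
    rw [hx, Finset.card_erase_of_mem hxS, Finset.card_erase_of_mem (Finset.mem_univ _), hcard,
      Finset.card_univ]
  obtain ⟨x', hx'S, hx'⟩ := Finset.mem_image.1
    (show c x ∈ (S.erase x).image c by rw [hx]; simpa using hcx)
  have hne : x' ≠ x := Finset.ne_of_mem_erase hx'S
  have : (S.filter fun x => (S.erase x).image c = Finset.univ.erase i₀) = {x, x'} := by
    ext z
    simp only [Finset.mem_filter, Finset.mem_insert, Finset.mem_singleton]
    constructor
    · rintro ⟨hzS, hz⟩
      by_contra! hzx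
      have hcz : c z ∈ (S.erase z).image c := by
        rw [hz, ← hx]
        exact Finset.mem_image_of_mem c (Finset.mem_erase.2 ⟨hzx.1, hzS⟩)
      obtain ⟨w, hw, hwz⟩ := Finset.mem_image.1 hcz
      obtain ⟨hwz', hwS⟩ := Finset.mem_erase.1 hw
      have hzm : z ∈ (S.erase x : Finset V) := Finset.mem_erase.2 ⟨hzx.1, hzS⟩
      by_cases hwx : w = x
      · exact hzx.2 (hinj hzm hx'S (by rw [← hwz, hwx, hx']))
      · exact hwz' (hinj (Finset.mem_erase.2 ⟨hwx, hwS⟩) hzm hwz)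
    · rintro (rfl | rfl)
      · exact ⟨hxS, hx⟩
      · refine ⟨Finset.mem_of_mem_erase hx'S, ?_⟩
        rw [← hx]
        have hxz : x ∈ S.erase z := Finset.mem_erase.2 ⟨hne.symm, hxS⟩
        rw [← Finset.insert_erase hxz, ← Finset.insert_erase hx'S, Finset.image_insert,
          Finset.image_insert, hx', Finset.erase_right_comm]
  rw [this, Finset.card_pair hne.symm]
  exact even_two

/-- **Scarf's lemma**: if every color `i` has a corner `v i` that is worst in ranking `i` and better
than all non-corner points in the other rankings, some dominant set carries each color once. -/
theorem exists_isDominant_image_eq_univ {ι V α : Type*} [Fintype ι] [Nonempty ι] [DecidableEq ι]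
    [Fintype V] [LinearOrder α] {r : ι → V → α} (hr : ∀ i, Function.Injective (r i))
    (c : V → ι) (v : ι → V) (hcv : ∀ i, c (v i) = i) (hmin : ∀ i y, r i (v i) ≤ r i y)
    (hmax : ∀ i j y, j ≠ i → y ∉ Set.range v → r i y < r i (v j)) :
    ∃ S : Finset V, IsDominant r S ∧ S.card = Fintype.card ι ∧ S.image c = Finset.univ := by
  classical
  by_contra! hno
  obtain ⟨i₀⟩ := ‹Nonempty ι›
  have hv : Function.Injective v := fun a b h => by rw [← hcv a, h, hcv]
  set rooms := Finset.univ.filter fun S : Finset V => IsDominant r S ∧ S.card = Fintype.card ι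
    with hrooms
  set doors := Finset.univ.filter fun D : Finset V => IsDominant r D ∧
    D.card + 1 = Fintype.card ι ∧ D.image c = Finset.univ.erase i₀ with hdoors
  set D₀ : Finset V := (Finset.univ.erase i₀).image v with hD₀
  have hcardpos : 0 < Fintype.card ι := Fintype.card_pos_iff.2 ⟨i₀⟩
  have memD₀ : ∀ y, y ∈ D₀ ↔ ∃ k, k ≠ i₀ ∧ v k = y := by simp [hD₀]
  have hD₀card : D₀.card + 1 = Fintype.card ι := by
    rw [hD₀, Finset.card_image_of_injective _ hv, Finset.card_erase_of_mem (Finset.mem_univ _),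
      Finset.card_univ]
    omega
  have hvi₀ : v i₀ ∉ D₀ := fun h => by
    obtain ⟨k, hk, h⟩ := (memD₀ _).1 h
    exact hk (hv h)
  -- the best point outside the corners other than `v i₀`
  obtain ⟨y, hy, hymax⟩ := (Finset.univ.filter (· ∉ D₀)).exists_max_image (r i₀)
    ⟨v i₀, by simpa using hvi₀⟩
  simp only [Finset.mem_filter, Finset.mem_univ, true_and] at hy hymax
  have hroom₀ : IsDominant r (insert y D₀) := by
    intro z
    by_cases hz : z ∈ D₀
    · obtain ⟨k, hk, rfl⟩ := (memD₀ _).1 hz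
      exact ⟨k, fun x _ => hmin k x⟩
    · refine ⟨i₀, fun x hx => ?_⟩
      rcases Finset.mem_insert.1 hx with rfl | hx
      · exact hymax z hz
      · obtain ⟨k, hk, rfl⟩ := (memD₀ _).1 hx
        by_cases hzv : z ∈ Set.range v
        · obtain ⟨l, rfl⟩ := hzv
          have : l = i₀ := by
            by_contra hl
            exact hz ((memD₀ _).2 ⟨l, hl, rfl⟩)
          subst this
          exact hmin _ _
        · exact (hmax i₀ k z hk hzv).le
  have hD₀door : D₀ ∈ doors := by
    simp only [hdoors, Finset.mem_filter, Finset.mem_univ, true_and]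
    refine ⟨hroom₀.mono (Finset.subset_insert _ _), hD₀card, ?_⟩
    rw [hD₀, Finset.image_image]
    simp [Function.comp_def, hcv]
  have habove₀ : (rooms.bipartiteAbove (· ⊆ ·) D₀).card = 1 := by
    rw [Finset.card_eq_one]
    refine ⟨insert y D₀, ?_⟩
    ext S
    simp only [Finset.bipartiteAbove, hrooms, Finset.mem_filter, Finset.mem_univ, true_and,
      Finset.mem_singleton]
    constructor
    · rintro ⟨⟨hS, hSc⟩, hDS⟩
      obtain ⟨i, hi⟩ := hS y
      have hii : i = i₀ := by
        by_contra hne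
        have hmem : v i ∈ D₀ := (memD₀ _).2 ⟨i, hne, rfl⟩
        exact hy (hr i (le_antisymm (hi _ (hDS hmem)) (hmin i y)) ▸ hmem)
      subst hii
      obtain ⟨z, hz⟩ := Finset.card_eq_one.1 (show (S \ D₀).card = 1 by
        rw [Finset.card_sdiff_of_subset hDS]; omega)
      obtain ⟨hzS, hzD⟩ := Finset.mem_sdiff.1 (hz ▸ Finset.mem_singleton_self z)
      have hzy : z = y := hr i (le_antisymm (hymax z hzD) (hi z hzS))
      rw [← Finset.sdiff_union_of_subset hDS, hz, hzy]
      rfl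
    · rintro rfl
      exact ⟨⟨hroom₀, by rw [Finset.card_insert_of_notMem hy, hD₀card]⟩,
        Finset.subset_insert _ _⟩
  have habove : ∀ D ∈ doors.erase D₀, (rooms.bipartiteAbove (· ⊆ ·) D).card = 2 := by
    intro D hDmem
    obtain ⟨hDne, hDmem⟩ := Finset.mem_erase.1 hDmem
    simp only [hdoors, Finset.mem_filter, Finset.mem_univ, true_and] at hDmem
    obtain ⟨hD, hDc, hDim⟩ := hDmem
    obtain ⟨t, htD, ht⟩ : ∃ t ∈ D, t ∉ Set.range v := by
      by_contra! hall
      apply hDne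
      apply Finset.eq_of_subset_of_card_le
      · intro x hx
        obtain ⟨k, rfl⟩ := hall x hx
        refine (memD₀ _).2 ⟨k, ?_, rfl⟩
        have := Finset.mem_image_of_mem c hx
        rw [hDim, hcv] at this
        exact Finset.ne_of_mem_erase this
      · omega
    have := hD.card_superset_eq_two hr ⟨t, htD⟩ hDc fun k => ⟨v k, fun l hl =>
      ⟨t, htD, hmax l k t hl.symm ht⟩⟩
    rw [← this]
    congr 1
    ext S
    simp [Finset.bipartiteAbove, hrooms, and_assoc]
  have hbelow : ∀ S ∈ rooms, Even (doors.bipartiteBelow (· ⊆ ·) S).card := by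
    intro S hS
    simp only [hrooms, Finset.mem_filter, Finset.mem_univ, true_and] at hS
    obtain ⟨hS, hSc⟩ := hS
    have := even_card_filter_image_erase c i₀ hSc (hno S hS hSc)
    convert this using 1
    symm
    apply Finset.card_bij (fun x _ => S.erase x)
    · intro x hx
      obtain ⟨hxS, hx⟩ := Finset.mem_filter.1 hx
      simp only [Finset.bipartiteBelow, hdoors, Finset.mem_filter, Finset.mem_univ, true_and]
      exact ⟨⟨hS.mono (Finset.erase_subset _ _), by rw [Finset.card_erase_of_mem hxS]; omega, hx⟩,
        Finset.erase_subset _ _⟩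
    · intro x hx z hz h
      exact Finset.erase_injOn S (Finset.mem_filter.1 hx).1 (Finset.mem_filter.1 hz).1 h
    · intro D hD
      simp only [Finset.bipartiteBelow, hdoors, Finset.mem_filter, Finset.mem_univ, true_and] at hD
      obtain ⟨⟨-, hDc, hDim⟩, hDS⟩ := hD
      obtain ⟨z, hz⟩ := Finset.card_eq_one.1 (show (S \ D).card = 1 by
        rw [Finset.card_sdiff_of_subset hDS]; omega)
      obtain ⟨hzS, -⟩ := Finset.mem_sdiff.1 (hz ▸ Finset.mem_singleton_self z)
      have hDz : S.erase z = D := by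
        rw [Finset.erase_eq, ← hz, Finset.sdiff_sdiff_eq_self hDS]
      exact ⟨z, Finset.mem_filter.2 ⟨hzS, by rw [hDz, hDim]⟩, hDz⟩
  have hcount := Finset.sum_card_bipartiteAbove_eq_sum_card_bipartiteBelow
    (s := doors) (t := rooms) (· ⊆ ·)
  rw [← Finset.add_sum_erase _ _ hD₀door, habove₀, Finset.sum_congr rfl habove] at hcount
  have heven := Finset.even_sum _ hbelow
  rw [← hcount, Finset.sum_const, smul_eq_mul] at heven
  exact absurd heven (by simp [parity_simps])

/-- A combinatorial form of Brouwer's theorem: at every scale `δ` there is a point each of whose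
coordinates is either at most `δ` or fails to decrease under `F` at some `δ`-close point. -/
theorem exists_approx_le_map_stdSimplex {A : Type*} [Fintype A] [Nonempty A]
    {F : (A → ℝ) → A → ℝ} (hF : Set.MapsTo F (stdSimplex ℝ A) (stdSimplex ℝ A))
    {δ : ℝ} (hδ : 0 < δ) :
    ∃ x₀ ∈ stdSimplex ℝ A, ∀ i, x₀ i ≤ δ ∨
      ∃ x ∈ stdSimplex ℝ A, dist x x₀ ≤ δ ∧ x i ≤ F x i := by
  classical
  have hn : (0 : ℝ) < Fintype.card A := by exact_mod_cast Fintype.card_pos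
  set γ : ℝ := δ / Fintype.card A with hγ
  have hγpos : 0 < γ := div_pos hδ hn
  obtain ⟨T, hTs, hTfin, hTcov⟩ := (isCompact_stdSimplex ℝ A).finite_cover_balls hγpos
  have : Fintype T := hTfin.fintype
  have hlabel : ∀ x ∈ stdSimplex ℝ A, ∃ i, x i ≤ F x i := by
    intro x hx
    by_contra! h
    have := Finset.sum_lt_sum_of_nonempty (Finset.univ_nonempty (α := A)) fun i _ => h i
    rw [hx.2, (hF hx).2] at this
    exact lt_irrefl _ this
  choose! lab hlab using hlabel
  let val : A → T ⊕ A → ℝ := fun i =>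
    Sum.elim (fun t => t.1 i) (fun j => if j = i then -1 else 2)
  let e := Fintype.equivFin (T ⊕ A)
  let r : A → T ⊕ A → Lex (ℝ × Fin (Fintype.card (T ⊕ A))) := fun i y => toLex (val i y, e y)
  have hle : ∀ {i y z}, r i y ≤ r i z → val i y ≤ val i z := by
    intro i y z h
    rcases (Prod.Lex.toLex_le_toLex).1 h with h | h
    · exact h.le
    · exact h.1.le
  have hlt : ∀ {i y z}, val i y < val i z → r i y < r i z := fun h =>
    Prod.Lex.toLex_lt_toLex.2 (Or.inl h)
  have hTi : ∀ (t : T) i, 0 ≤ t.1 i ∧ t.1 i ≤ 1 := fun t i =>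
    mem_Icc_of_mem_stdSimplex (hTs t.2) i
  obtain ⟨S, hS, -, hSim⟩ := exists_isDominant_image_eq_univ (r := r)
    (fun i y z h => e.injective (congrArg (fun p => (ofLex p).2) h))
    (Sum.elim (fun t => lab t.1) id) Sum.inr (fun _ => rfl)
    (by
      rintro i (t | j)
      · refine (hlt ?_).le
        simp only [val, Sum.elim_inl, Sum.elim_inr, if_true]
        linarith [(hTi t i).1]
      · by_cases h : j = i
        · rw [h]
        · refine (hlt ?_).le
          simp only [val, Sum.elim_inr, if_true, if_neg h]
          norm_num)
    (by
      rintro i j (t | k) hji hy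
      · refine hlt ?_
        simp only [val, Sum.elim_inl, Sum.elim_inr, if_neg hji]
        linarith [(hTi t i).2]
      · exact absurd ⟨k, rfl⟩ hy)
  have hdom : ∀ t : T, ∃ i, Sum.inr i ∉ S ∧ ∀ x : T, Sum.inl x ∈ S → t.1 i ≤ x.1 i := by
    intro t
    obtain ⟨i, hi⟩ := hS (Sum.inl t)
    refine ⟨i, fun h => ?_, fun x hx => hle (hi _ hx)⟩
    have := hle (hi _ h)
    simp only [val, Sum.elim_inl, Sum.elim_inr, if_true] at this
    linarith [(hTi t i).1]
  have hTne : Nonempty T := by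
    obtain ⟨x, hx⟩ : (stdSimplex ℝ A).Nonempty :=
      ⟨_, single_mem_stdSimplex ℝ (Classical.arbitrary A)⟩
    obtain ⟨t, ht, -⟩ := Set.mem_iUnion₂.1 (hTcov hx)
    exact ⟨⟨t, ht⟩⟩
  have hcol : ∀ i, Sum.inr i ∉ S → ∃ x : T, Sum.inl x ∈ S ∧ lab x.1 = i := by
    intro i hi
    have : i ∈ S.image (Sum.elim (fun t : T => lab t.1) id) := hSim ▸ Finset.mem_univ i
    obtain ⟨y | j, hy, hyi⟩ := Finset.mem_image.1 this
    · exact ⟨y, hy, hyi⟩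
    · simp only [Sum.elim_inr, id] at hyi
      exact absurd (hyi ▸ hy) hi
  set σ : Finset T := Finset.univ.filter fun x => Sum.inl x ∈ S with hσ
  have hmemσ : ∀ x, x ∈ σ ↔ Sum.inl x ∈ S := by simp [hσ]
  have hσne : σ.Nonempty := by
    obtain ⟨t⟩ := hTne
    obtain ⟨i, hi, -⟩ := hdom t
    obtain ⟨x, hx, -⟩ := hcol i hi
    exact ⟨x, (hmemσ x).2 hx⟩
  choose w hwσ hw using fun i => σ.exists_min_image (fun x => x.1 i) hσne
  set C : Finset A := Finset.univ.filter fun i => Sum.inr i ∉ S with hC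
  have hmemC : ∀ i, i ∈ C ↔ Sum.inr i ∉ S := by simp [hC]
  set m : A → ℝ := fun i => if i ∈ C then (w i).1 i else 0 with hm
  have hm0 : ∀ i, 0 ≤ m i := by
    intro i
    simp only [hm]
    split_ifs
    · exact (hTi _ i).1
    · exact le_rfl
  have hmle : ∀ x ∈ σ, ∀ i, m i ≤ x.1 i := by
    intro x hx i
    simp only [hm]
    split_ifs
    · exact hw i x hx
    · exact (hTi _ i).1
  have hsum : 1 - ∑ i, m i ≤ δ := by
    by_contra! hlt
    set s : ℝ := (1 - ∑ i, m i) / Fintype.card A with hs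
    have hsγ : γ < s := div_lt_div_of_pos_right hlt hn
    have hz : (fun i => m i + s) ∈ stdSimplex ℝ A := by
      refine ⟨fun i => add_nonneg (hm0 i) (hγpos.le.trans hsγ.le), ?_⟩
      rw [Finset.sum_add_distrib, Finset.sum_const, Finset.card_univ, nsmul_eq_mul, hs,
        mul_div_cancel₀ _ hn.ne']
      ring
    obtain ⟨t, ht, hzt⟩ := Set.mem_iUnion₂.1 (hTcov hz)
    obtain ⟨i, hi, hti⟩ := hdom ⟨t, ht⟩
    have h1 : t i ≤ m i := by
      simp only [hm, if_pos ((hmemC i).2 hi)]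
      exact hti _ ((hmemσ _).1 (hwσ i))
    have h2 := (dist_pi_lt_iff hγpos).1 (Metric.mem_ball.1 hzt) i
    rw [Real.dist_eq, abs_lt] at h2
    linarith [h2.2]
  have hclose : ∀ x ∈ σ, ∀ i, x.1 i ≤ m i + δ := by
    intro x hx i
    have h1 : x.1 i - m i ≤ ∑ j, (x.1 j - m j) :=
      Finset.single_le_sum (f := fun j => x.1 j - m j)
        (fun j _ => sub_nonneg.2 (hmle x hx j)) (Finset.mem_univ i)
    rw [Finset.sum_sub_distrib, (hTs x.2).2] at h1
    linarith
  obtain ⟨x₀, hx₀⟩ := hσne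
  refine ⟨x₀.1, hTs x₀.2, fun i => ?_⟩
  by_cases hi : Sum.inr i ∈ S
  · left
    have := hclose x₀ hx₀ i
    have h0 : m i = 0 := by
      simp only [hm]
      rw [if_neg]
      rw [hmemC]
      exact not_not.2 hi
    linarith
  · right
    obtain ⟨x, hxS, hxi⟩ := hcol i hi
    have hxσ := (hmemσ x).2 hxS
    refine ⟨x.1, hTs x.2, (dist_pi_le_iff hδ.le).2 fun j => ?_, hxi ▸ hlab _ (hTs x.2)⟩
    rw [Real.dist_eq, abs_le]
    constructor <;> linarith [hclose x hxσ j, hclose x₀ hx₀ j, hmle x hxσ j, hmle x₀ hx₀ j]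

/-- **Brouwer's fixed point theorem** on the standard simplex. -/
theorem exists_fixedPoint_stdSimplex {A : Type*} [Fintype A] [Nonempty A]
    {F : (A → ℝ) → A → ℝ} (hF : Set.MapsTo F (stdSimplex ℝ A) (stdSimplex ℝ A))
    (hFc : ContinuousOn F (stdSimplex ℝ A)) : ∃ x ∈ stdSimplex ℝ A, F x = x := by
  classical
  have hcomp := isCompact_stdSimplex ℝ A
  have hsup : ∀ γ > 0, ∃ x ∈ stdSimplex ℝ A, ∀ i, x i ≤ F x i + γ := by
    intro γ hγ
    obtain ⟨δ, hδ, huc⟩ := Metric.uniformContinuousOn_iff.1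
      (hcomp.uniformContinuousOn_of_continuous hFc) (γ / 2) (half_pos hγ)
    set ρ := min (δ / 2) (γ / 2) with hρ
    have hρpos : 0 < ρ := lt_min (half_pos hδ) (half_pos hγ)
    have hργ : ρ ≤ γ / 2 := min_le_right _ _
    obtain ⟨x₀, hx₀, h⟩ := exists_approx_le_map_stdSimplex hF hρpos
    refine ⟨x₀, hx₀, fun i => ?_⟩
    rcases h i with h | ⟨x, hx, hd, hxi⟩
    · linarith [(hF hx₀).1 i]
    · have h1 : dist (F x) (F x₀) < γ / 2 :=
        huc x hx x₀ hx₀ (hd.trans_lt ((min_le_left _ _).trans_lt (half_lt_self hδ)))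
      have h2 := (dist_le_pi_dist (F x) (F x₀) i).trans_lt h1
      have h3 := (dist_le_pi_dist x x₀ i).trans hd
      rw [Real.dist_eq, abs_lt] at h2
      rw [Real.dist_eq, abs_le] at h3
      linarith [h2.2, h3.1]
  let g : (A → ℝ) → ℝ := fun x => ∑ i, max 0 (x i - F x i)
  have hg : ContinuousOn g (stdSimplex ℝ A) := by
    refine continuousOn_finsetSum _ fun i _ => continuousOn_const.sup ?_
    exact (continuous_apply i).continuousOn.sub ((continuous_apply i).comp_continuousOn hFc)
  obtain ⟨x, hx, hmin⟩ := hcomp.exists_isMinOn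
    ⟨_, single_mem_stdSimplex ℝ (Classical.arbitrary A)⟩ hg
  have hn : (0 : ℝ) < Fintype.card A := by exact_mod_cast Fintype.card_pos
  have hgx : g x ≤ 0 := by
    refine le_of_forall_pos_le_add fun γ hγ => ?_
    obtain ⟨y, hy, hyγ⟩ := hsup (γ / Fintype.card A) (div_pos hγ hn)
    calc g x ≤ g y := hmin hy
      _ ≤ ∑ _i : A, γ / Fintype.card A := Finset.sum_le_sum fun i _ =>
          max_le (div_pos hγ hn).le (by linarith [hyγ i])
      _ = 0 + γ := by
          rw [Finset.sum_const, Finset.card_univ, nsmul_eq_mul, mul_div_cancel₀ _ hn.ne', zero_add]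
  have hle : ∀ i, x i ≤ F x i := by
    intro i
    have h1 : max 0 (x i - F x i) ≤ g x :=
      Finset.single_le_sum (f := fun i => max 0 (x i - F x i))
        (fun _ _ => le_max_left _ _) (Finset.mem_univ i)
    linarith [le_max_right 0 (x i - F x i)]
  refine ⟨x, hx, funext fun i => ?_⟩
  have := (Finset.sum_eq_sum_iff_of_le fun i _ => hle i).1 (hx.2.trans (hF hx).2.symm)
  exact (this i (Finset.mem_univ i)).symm

/-- The softmax (logit) weights of a vector. -/
noncomputable def softmax {A : Type*} [Fintype A] (w : A → ℝ) (a : A) : ℝ :=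
  Real.exp (w a) / ∑ b, Real.exp (w b)

section Softmax

variable {A : Type*} [Fintype A]

theorem sum_exp_pos [Nonempty A] (w : A → ℝ) : 0 < ∑ b, Real.exp (w b) :=
  Finset.sum_pos (fun _ _ => Real.exp_pos _) Finset.univ_nonempty

theorem softmax_mem_stdSimplex [Nonempty A] (w : A → ℝ) : softmax w ∈ stdSimplex ℝ A := by
  refine ⟨fun a => div_nonneg (Real.exp_pos _).le (sum_exp_pos w).le, ?_⟩
  simp only [softmax]
  rw [← Finset.sum_div, div_self (sum_exp_pos w).ne']

theorem softmax_le_exp_sub (w : A → ℝ) (a b : A) : softmax w a ≤ Real.exp (w a - w b) := by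
  rw [Real.exp_sub]
  exact div_le_div_of_nonneg_left (Real.exp_pos _).le (Real.exp_pos _)
    (Finset.single_le_sum (f := fun b => Real.exp (w b)) (fun _ _ => (Real.exp_pos _).le)
      (Finset.mem_univ b))

theorem continuous_softmax [Nonempty A] (a : A) : Continuous fun w : A → ℝ => softmax w a :=
  (Real.continuous_exp.comp (continuous_apply a)).div
    (continuous_finsetSum _ fun b _ => Real.continuous_exp.comp (continuous_apply b))
    fun w => (sum_exp_pos w).ne'

end Softmax

/-- The set of maximizers of a vector. -/
noncomputable def argmaxSet {A : Type*} [Fintype A] (w : A → ℝ) : Finset A :=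
  open Classical in Finset.univ.filter fun a => ∀ b, w b ≤ w a

section ArgmaxSet

variable {A : Type*} [Fintype A]

theorem mem_argmaxSet {w : A → ℝ} {a : A} : a ∈ argmaxSet w ↔ ∀ b, w b ≤ w a := by
  simp [argmaxSet]

theorem argmaxSet_nonempty [Nonempty A] (w : A → ℝ) : (argmaxSet w).Nonempty := by
  obtain ⟨a, -, ha⟩ := Finset.univ.exists_max_image w Finset.univ_nonempty
  exact ⟨a, mem_argmaxSet.2 fun b => ha b (Finset.mem_univ b)⟩

theorem measurableSet_argmaxSet_eq {I : Type*} [MeasurableSpace I] {w : I → A → ℝ}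
    (hw : ∀ a, Measurable fun i => w i a) (S : Finset A) :
    MeasurableSet {i | argmaxSet (w i) = S} := by
  have : {i | argmaxSet (w i) = S} = {i | ∀ a, a ∈ S ↔ ∀ b, w i b ≤ w i a} := by
    ext i
    simp only [Set.mem_ofPred_eq, Finset.ext_iff, mem_argmaxSet]
    exact forall_congr' fun a => Iff.comm
  rw [this]
  refine measurableSet_setOfPred.2 (Measurable.forall fun a => ?_)
  refine Measurable.iff measurable_const (Measurable.forall fun b => ?_)
  exact measurableSet_setOfPred.1 (measurableSet_le (hw b) (hw a))

theorem measurable_comp_argmaxSet {I : Type*} [MeasurableSpace I] {w : I → A → ℝ}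
    (hw : ∀ a, Measurable fun i => w i a) (g : Finset A → ℝ) :
    Measurable fun i => g (argmaxSet (w i)) := by
  let _ : MeasurableSpace (Finset A) := ⊤
  exact (measurable_from_top (f := g)).comp
    (measurable_to_countable' fun S => measurableSet_argmaxSet_eq hw S)

/-- Weights supported on the maximizers of `w` maximize the `w`-average over the simplex. -/
theorem sum_mul_le_of_support_argmaxSet [Nonempty A] {w μ μ' : A → ℝ} (hμ : μ ∈ stdSimplex ℝ A)
    (hsupp : ∀ a, a ∉ argmaxSet w → μ a = 0) (hμ' : μ' ∈ stdSimplex ℝ A) :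
    ∑ a, μ' a * w a ≤ ∑ a, μ a * w a := by
  obtain ⟨m, hm⟩ := argmaxSet_nonempty w
  have hmax := mem_argmaxSet.1 hm
  calc ∑ a, μ' a * w a ≤ ∑ a, μ' a * w m :=
        Finset.sum_le_sum fun a _ => mul_le_mul_of_nonneg_left (hmax a) (hμ'.1 a)
    _ = w m := by rw [← Finset.sum_mul, hμ'.2, one_mul]
    _ = ∑ a, μ a * w m := by rw [← Finset.sum_mul, hμ.2, one_mul]
    _ = ∑ a, μ a * w a := Finset.sum_congr rfl fun a _ => by
        by_cases ha : a ∈ argmaxSet w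
        · rw [le_antisymm (mem_argmaxSet.1 ha m) (hmax a)]
        · rw [hsupp a ha, zero_mul, zero_mul]

/-- Integrals split along the finitely many possible sets of maximizers. -/
theorem integral_eq_sum_argmaxSet {I : Type*} [MeasurableSpace I] {lam : Measure I}
    {w : I → A → ℝ} (hw : ∀ a, Measurable fun i => w i a) {f : I → ℝ} (hf : Integrable f lam) :
    ∫ i, f i ∂lam = ∑ S : Finset A, ∫ i in {i | argmaxSet (w i) = S}, f i ∂lam := by
  rw [← integral_iUnion_fintype (measurableSet_argmaxSet_eq hw) _ fun _ => hf.integrableOn]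
  · rw [show (⋃ S, {i | argmaxSet (w i) = S}) = Set.univ by ext i; simp, setIntegral_univ]
  · intro S S' hne
    exact Set.disjoint_left.2 fun i (hi : _ = S) (hi' : _ = S') => hne (hi ▸ hi')

end ArgmaxSet

/-- Integrals of simplex-valued profiles lie in the simplex. -/
theorem integral_mem_stdSimplex {I A : Type*} [MeasurableSpace I] [Fintype A] {lam : Measure I}
    [IsProbabilityMeasure lam] {p : I → A → ℝ} (hp : ∀ i, p i ∈ stdSimplex ℝ A)
    (hfi : ∀ a, Integrable (fun i => p i a) lam) :
    (fun a => ∫ i, p i a ∂lam) ∈ stdSimplex ℝ A := by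
  refine ⟨fun a => integral_nonneg fun i => (hp i).1 a, ?_⟩
  rw [← integral_finsetSum _ fun a _ => hfi a]
  simp [(hp _).2]

theorem integrable_of_mem_stdSimplex {I A : Type*} [MeasurableSpace I] [Fintype A]
    {lam : Measure I} [IsFiniteMeasure lam] {p : I → A → ℝ} (hp : ∀ i, p i ∈ stdSimplex ℝ A)
    {a : A} (hm : Measurable fun i => p i a) : Integrable (fun i => p i a) lam :=
  Integrable.of_bound hm.aestronglyMeasurable 1 (ae_of_all _ fun i => by
    rw [Real.norm_of_nonneg ((hp i).1 a)]
    exact (mem_Icc_of_mem_stdSimplex (hp i) a).2)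

section Equilibrium

variable {I A : Type*} [MeasurableSpace I] [Fintype A] [Nonempty A] {lam : Measure I}
  [IsProbabilityMeasure lam] {W : I → A → (A → ℝ) → ℝ} {β : ℝ} {ν : A → ℝ}

theorem measurable_softmax_comp (hWm : ∀ a, ∀ τ ∈ stdSimplex ℝ A, Measurable fun i => W i a τ)
    (t : ℝ) {τ : A → ℝ} (hτ : τ ∈ stdSimplex ℝ A) (a : A) :
    Measurable fun i => softmax (fun b => t * W i b τ) a :=
  (continuous_softmax a).measurable.comp
    (measurable_pi_lambda _ fun b => (hWm b τ hτ).const_mul t)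

/-- A logit equilibrium exists at every precision `t`. -/
theorem exists_softmax_equilibrium (hWc : ∀ i a, ContinuousOn (W i a) (stdSimplex ℝ A))
    (hWm : ∀ a, ∀ τ ∈ stdSimplex ℝ A, Measurable fun i => W i a τ)
    (hβ : β ∈ Set.Icc (0 : ℝ) 1) (hν : ν ∈ stdSimplex ℝ A) (t : ℝ) :
    ∃ τ ∈ stdSimplex ℝ A, ∀ a,
      τ a = β * ∫ i, softmax (fun b => t * W i b τ) a ∂lam + (1 - β) * ν a := by
  let F : (A → ℝ) → A → ℝ := fun τ a =>
    β * ∫ i, softmax (fun b => t * W i b τ) a ∂lam + (1 - β) * ν a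
  have hF : Set.MapsTo F (stdSimplex ℝ A) (stdSimplex ℝ A) := fun τ hτ =>
    convex_stdSimplex ℝ A (integral_mem_stdSimplex (lam := lam)
      (fun i => softmax_mem_stdSimplex fun b => t * W i b τ) fun a =>
        integrable_of_mem_stdSimplex (fun i => softmax_mem_stdSimplex _)
          (measurable_softmax_comp hWm t hτ a)) hν hβ.1 (sub_nonneg.2 hβ.2) (by ring)
  have hFc : ContinuousOn F (stdSimplex ℝ A) := by
    refine continuousOn_pi.2 fun a => ContinuousOn.add (continuousOn_const.mul ?_)
      continuousOn_const
    refine continuousOn_of_dominated (bound := fun _ => 1) (fun τ hτ =>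
      (measurable_softmax_comp hWm t hτ a).aestronglyMeasurable)
      (fun τ _ => ae_of_all _ fun i => ?_) (integrable_const _) (ae_of_all _ fun i => ?_)
    · have h := softmax_mem_stdSimplex fun b => t * W i b τ
      rw [Real.norm_of_nonneg (h.1 a)]
      exact (mem_Icc_of_mem_stdSimplex h a).2
    · exact (continuous_softmax a).comp_continuousOn
        (continuousOn_pi.2 fun b => continuousOn_const.mul (hWc i b))
  obtain ⟨τ, hτ, h⟩ := exists_fixedPoint_stdSimplex hF hFc
  exact ⟨τ, hτ, fun a => (congrFun h a).symm⟩

/-- Existence of an aggregate `τ` generated by best responses to `τ`, mixed with `ν`, in which the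
response of a player depends only on the player's set of optimal actions. -/
theorem exists_argmaxSet_equilibrium (hWc : ∀ i a, ContinuousOn (W i a) (stdSimplex ℝ A))
    (hWm : ∀ a, ∀ τ ∈ stdSimplex ℝ A, Measurable fun i => W i a τ)
    (hβ : β ∈ Set.Icc (0 : ℝ) 1) (hν : ν ∈ stdSimplex ℝ A) :
    ∃ τ ∈ stdSimplex ℝ A, ∃ μ : Finset A → A → ℝ,
      (∀ S : Finset A, S.Nonempty → μ S ∈ stdSimplex ℝ A ∧ ∀ a ∉ S, μ S a = 0) ∧
      ∀ a, τ a = β * ∫ i, μ (argmaxSet fun b => W i b τ) a ∂lam + (1 - β) * ν a := by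
  classical
  choose x hx hxeq using fun n : ℕ =>
    exists_softmax_equilibrium (lam := lam) hWc hWm hβ hν (n : ℝ)
  obtain ⟨τ, hτ, φ, hφ, hlim⟩ := (isCompact_stdSimplex ℝ A).tendsto_subseq hx
  have hlimW : ∀ i a, Tendsto (fun n => W i a (x (φ n))) atTop (𝓝 (W i a τ)) := fun i a =>
    ((hWc i a) τ hτ).tendsto.comp (tendsto_nhdsWithin_iff.2 
      ⟨hlim, Eventually.of_forall fun n => hx _⟩)
  set E : Finset A → Set I := fun S => {i | argmaxSet (fun b => W i b τ) = S} with hE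
  have hEm : ∀ S, MeasurableSet (E S) := measurableSet_argmaxSet_eq fun a => hWm a τ hτ
  set p : ℕ → I → A → ℝ := fun n i => softmax fun b => (n : ℝ) * W i b (x n) with hp
  have hpΔ : ∀ n i, p n i ∈ stdSimplex ℝ A := fun n i => softmax_mem_stdSimplex _
  have hpm : ∀ n a, Measurable fun i => p n i a := fun n a =>
    measurable_softmax_comp hWm n (hx n) a
  have hpint : ∀ n a, Integrable (fun i => p n i a) lam := fun n a =>
    integrable_of_mem_stdSimplex (hpΔ n) (hpm n a)
  have hp1 : ∀ n i a, ‖p n i a‖ ≤ 1 := fun n i a => by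
    rw [Real.norm_of_nonneg ((hpΔ n i).1 a)]
    exact (mem_Icc_of_mem_stdSimplex (hpΔ n i) a).2
  set q : ℕ → Finset A → A → ℝ := fun n S a => ∫ i in E S, p n i a ∂lam with hq
  have hq0 : ∀ n S a, 0 ≤ q n S a := fun n S a => integral_nonneg fun i => (hpΔ n i).1 a
  have hqsum : ∀ n S, ∑ a, q n S a = lam.real (E S) := fun n S => by
    simp only [hq]
    rw [← integral_finsetSum _ fun a _ => (hpint n a).integrableOn]
    simp [(hpΔ n _).2]
  have hqIcc : ∀ n, q n ∈ Set.Icc (0 : Finset A → A → ℝ) 1 := fun n =>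
    ⟨fun S a => hq0 n S a, fun S a =>
      (Finset.single_le_sum (fun b _ => hq0 n S b) (Finset.mem_univ a)).trans
        ((hqsum n S).le.trans measureReal_le_one)⟩
  obtain ⟨Q, hQ, ψ, hψ, hlimQ⟩ := isCompact_Icc.tendsto_subseq fun n => hqIcc (φ n)
  have hlimQ' : ∀ S a, Tendsto (fun n => q (φ (ψ n)) S a) atTop (𝓝 (Q S a)) := fun S a =>
    tendsto_pi_nhds.1 (tendsto_pi_nhds.1 hlimQ S) a
  have hQsum : ∀ S, ∑ a, Q S a = lam.real (E S) := fun S =>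
    tendsto_nhds_unique (tendsto_finsetSum _ fun a _ => hlimQ' S a) (by simp [hqsum])
  have hQ0 : ∀ S a, 0 ≤ Q S a := fun S a => hQ.1 S a
  have hQsupp : ∀ S, ∀ a ∉ S, Q S a = 0 := by
    intro S a ha
    refine tendsto_nhds_unique (hlimQ' S a) ?_
    have := tendsto_integral_of_dominated_convergence (μ := lam.restrict (E S))
      (F := fun n i => p (φ (ψ n)) i a) (f := fun _ => 0) (fun _ => 1)
      (fun n => (hpm _ a).aestronglyMeasurable) (integrable_const _)
      (fun n => ae_of_all _ fun i => hp1 _ i a) ?_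
    · simpa using this
    · filter_upwards [ae_restrict_mem (hEm S)] with i hi
      obtain ⟨b, hb⟩ : ∃ b, W i a τ < W i b τ := by
        by_contra! h
        exact ha ((show argmaxSet (fun b => W i b τ) = S from hi) ▸ mem_argmaxSet.2 h)
      have hgap : Tendsto (fun n => W i a (x (φ (ψ n))) - W i b (x (φ (ψ n)))) atTop
          (𝓝 (W i a τ - W i b τ)) :=
        ((hlimW i a).sub (hlimW i b)).comp hψ.tendsto_atTop
      have hcast : Tendsto (fun n => ((φ (ψ n) : ℕ) : ℝ)) atTop atTop :=
        tendsto_natCast_atTop_atTop.comp (hφ.comp hψ).tendsto_atTop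
      have hexp := Real.tendsto_exp_atBot.comp (hcast.atTop_mul_neg (sub_neg.2 hb) hgap)
      refine squeeze_zero (fun n => (hpΔ _ i).1 a) (fun n => ?_) hexp
      have := softmax_le_exp_sub (fun c => ((φ (ψ n) : ℕ) : ℝ) * W i c (x (φ (ψ n)))) a b
      rwa [← mul_sub] at this
  have hτeq : ∀ a, τ a = β * ∑ S, Q S a + (1 - β) * ν a := by
    intro a
    have h1 : Tendsto (fun n => x (φ (ψ n)) a) atTop (𝓝 (τ a)) :=
      (tendsto_pi_nhds.1 hlim a).comp hψ.tendsto_atTop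
    refine tendsto_nhds_unique h1 ?_
    have h2 : ∀ n, x n a = β * ∑ S, q n S a + (1 - β) * ν a := fun n => by
      rw [hxeq n a, integral_eq_sum_argmaxSet (fun a => hWm a τ hτ) (hpint n a)]
    simp only [h2]
    exact ((tendsto_finsetSum _ fun S _ => hlimQ' S a).const_mul β).add tendsto_const_nhds
  have hexμ : ∀ S : Finset A, S.Nonempty → ∃ m ∈ stdSimplex ℝ A,
      (∀ a ∉ S, m a = 0) ∧ ∀ a, lam.real (E S) * m a = Q S a := by
    intro S hS
    by_cases h : lam.real (E S) = 0
    · obtain ⟨s, hs⟩ := hS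
      refine ⟨Pi.single s 1, single_mem_stdSimplex ℝ s, fun a ha =>
        Pi.single_eq_of_ne (fun has : a = s => ha (has ▸ hs)) 1, fun a => ?_⟩
      have := (Finset.sum_eq_zero_iff_of_nonneg fun a _ => hQ0 S a).1 ((hQsum S).trans h)
      rw [this a (Finset.mem_univ a), h, zero_mul]
    · refine ⟨fun a => Q S a / lam.real (E S),
        ⟨fun a => div_nonneg (hQ0 S a) measureReal_nonneg, ?_⟩, fun a ha => ?_, fun a =>
        mul_div_cancel₀ _ h⟩
      · rw [← Finset.sum_div, hQsum, div_self h]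
      · simp only [hQsupp S a ha, zero_div]
  choose! μ hμΔ hμsupp hμQ using hexμ
  refine ⟨τ, hτ, μ, fun S hS => ⟨hμΔ S hS, hμsupp S hS⟩, fun a => ?_⟩
  have hfi : Integrable (fun i => μ (argmaxSet fun b => W i b τ) a) lam :=
    integrable_of_mem_stdSimplex (fun i => hμΔ _ (argmaxSet_nonempty _))
      (measurable_comp_argmaxSet (fun a => hWm a τ hτ) fun S => μ S a)
  rw [hτeq a, integral_eq_sum_argmaxSet (fun a => hWm a τ hτ) hfi]
  congr 2
  refine Finset.sum_congr rfl fun S _ => ?_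
  have hcongr : ∫ i in E S, μ (argmaxSet fun b => W i b τ) a ∂lam = ∫ _ in E S, μ S a ∂lam :=
    setIntegral_congr_fun (hEm S) fun i (hi : argmaxSet _ = S) => by simp only [hi]
  rw [hcongr, setIntegral_const, smul_eq_mul]
  rcases S.eq_empty_or_nonempty with rfl | hS
  · have hempty : E ∅ = ∅ := Set.eq_empty_of_forall_notMem fun i (hi : argmaxSet _ = ∅) =>
      (argmaxSet_nonempty _).ne_empty hi
    rw [hQsupp ∅ a (Finset.notMem_empty a), hempty]
    simp
  · rw [hμQ S hS]

end Equilibrium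

section Perturbation

variable {A : Type*} [Fintype A] {ε : ℝ} {η : Measure (A → ℝ)}

theorem FullSupportOnSimplex.restrict_eq (hη : FullSupportOnSimplex η) :
    η.restrict (stdSimplex ℝ A) = η :=
  Measure.restrict_eq_self_of_ae_mem (mem_ae_iff.2 hη.2.1)

theorem FullSupportOnSimplex.integrable (hη : FullSupportOnSimplex η) {f : (A → ℝ) → ℝ}
    (hf : ContinuousOn f (stdSimplex ℝ A)) : Integrable f η := by
  have := hη.1
  rw [← hη.restrict_eq]
  exact hf.integrableOn_compact (isCompact_stdSimplex ℝ A)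

theorem integral_pertOf (hε : ε ∈ Set.Ioo (0 : ℝ) 1) (hη : FullSupportOnSimplex η)
    {f : (A → ℝ) → ℝ} (hf : ContinuousOn f (stdSimplex ℝ A)) (τ : A → ℝ) :
    ∫ x, f x ∂(pertOf ε η τ) = (1 - ε) * f τ + ε * ∫ x, f x ∂η := by
  rw [pertOf, integral_add_measure
    ((integrable_dirac (by simp)).smul_measure ENNReal.ofReal_ne_top)
    ((hη.integrable hf).smul_measure ENNReal.ofReal_ne_top), integral_smul_measure,
    integral_smul_measure, integral_dirac, ENNReal.toReal_ofReal (sub_nonneg.2 hε.2.le),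
    ENNReal.toReal_ofReal hε.1.le, smul_eq_mul, smul_eq_mul]

theorem isPerturbation_pertOf (hε : ε ∈ Set.Ioo (0 : ℝ) 1) (hη : FullSupportOnSimplex η) :
    IsPerturbation (pertOf ε η) := by
  have := hη.1
  refine ⟨fun τ hτ => ⟨⟨?_⟩, ?_, fun U hU hne => ?_⟩, fun f hf => ?_⟩
  · simp only [pertOf, Measure.add_apply, Measure.smul_apply, measure_univ, smul_eq_mul, mul_one]
    rw [← ENNReal.ofReal_add (sub_nonneg.2 hε.2.le) hε.1.le]
    simp
  · simp [pertOf, hη.2.1, hτ,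
      Measure.dirac_apply' τ (isClosed_stdSimplex ℝ A).measurableSet.compl]
  · simp only [pertOf, Measure.add_apply, Measure.smul_apply, smul_eq_mul]
    exact (ENNReal.mul_pos (ENNReal.ofReal_pos.2 hε.1).ne' (hη.2.2 U hU hne).ne').trans_le
      le_add_self
  · simp only [integral_pertOf hε hη hf.continuousOn]
    exact (hf.measurable.const_mul _).add_const _

theorem ofReal_le_pertOf_singleton (τ : A → ℝ) :
    ENNReal.ofReal (1 - ε) ≤ pertOf ε η τ {τ} := by
  simp [pertOf]

/-- The average payoff of an action against `η` is measurable in the player. -/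
theorem IsLargeGame.measurable_integral {I : Type*} [MeasurableSpace I]
    {u : I → A → (A → ℝ) → ℝ} (hu : IsLargeGame u) (hη : FullSupportOnSimplex η) (a : A) :
    Measurable fun i => ∫ x, u i a x ∂η := by
  have := hη.1
  have hmeas : MeasurableSet (stdSimplex ℝ A) := (isClosed_stdSimplex ℝ A).measurableSet
  have hjoint : StronglyMeasurable
      (Function.uncurry fun (x : stdSimplex ℝ A) (i : I) => u i a x.1) :=
    stronglyMeasurable_uncurry_of_continuous_of_stronglyMeasurable
      (fun i => (hu.1 i a).domRestrict) fun x => (hu.2 a x.1 x.2).stronglyMeasurable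
  have hrestrict : ∀ i, ∫ x, u i a x ∂η =
      ∫ x : stdSimplex ℝ A, u i a x.1 ∂(η.comap Subtype.val) := fun i => by
    rw [integral_subtype_comap hmeas, hη.restrict_eq]
  simp only [hrestrict]
  exact hjoint.integral_prod_left'.measurable

end Perturbation

/-- For `ε ∈ (0,1)` and any full-support probability measure `η`
on the simplex, with the perturbation function `φ(τ) = (1-ε)δ_τ + εη`, every large
game has a symmetric randomized strategy profile `h` such that each `h i` equals
`(1-ε)μᵢ + εν` for some `μᵢ` maximizing the expected payoff against `φ(s(h))`,
where `ν` is the uniform distribution on actions; in particular, `h` is a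
symmetric `ε`-robust perfect equilibrium with perturbed player space all of `I`. -/
theorem statement5 {I : Type*} [MeasurableSpace I] {A : Type*} [Fintype A] [Nonempty A]
    (lam : Measure I) [IsProbabilityMeasure lam] (hatomless : MeasAtomless lam)
    (u : I → A → (A → ℝ) → ℝ) (hu : IsLargeGame u)
    (ε : ℝ) (hε : ε ∈ Set.Ioo (0:ℝ) 1)
    (η : Measure (A → ℝ)) (hη : FullSupportOnSimplex η) :
    ∃ h : I → A → ℝ, IsProfile lam h ∧ (∀ i i' : I, u i = u i' → h i = h i') ∧
      (∀ i : I, ∃ μ ∈ stdSimplex ℝ A,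
        (∀ μ' ∈ stdSimplex ℝ A,
          ∑ a, μ' a * payM (u i) a (pertOf ε η (socSum lam h)) ≤
            ∑ a, μ a * payM (u i) a (pertOf ε η (socSum lam h))) ∧
        ∀ a : A, h i a = (1 - ε) * μ a + ε * (1 / (Fintype.card A : ℝ))) ∧
      IsEpsRPE lam u ε h Set.univ (pertOf ε η) := by
  have hK : (0 : ℝ) < Fintype.card A := by exact_mod_cast Fintype.card_pos
  have hν : (fun _ : A => 1 / (Fintype.card A : ℝ)) ∈ stdSimplex ℝ A :=
    ⟨fun _ => by positivity, by simp [hK.ne']⟩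
  have hpay : ∀ i a τ, payM (u i) a (pertOf ε η τ) = (1 - ε) * u i a τ + ε * ∫ x, u i a x ∂η :=
    fun i a τ => integral_pertOf hε hη (hu.1 i a) τ
  have hWm : ∀ a, ∀ τ ∈ stdSimplex ℝ A, Measurable fun i => payM (u i) a (pertOf ε η τ) := by
    intro a τ hτ
    simp only [hpay]
    exact ((hu.2 a τ hτ).const_mul _).add ((hu.measurable_integral hη a).const_mul _)
  obtain ⟨τ, hτ, μ, hμ, hτeq⟩ := exists_argmaxSet_equilibrium (lam := lam)
    (W := fun i a τ => payM (u i) a (pertOf ε η τ)) (β := 1 - ε)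
    (fun i a => by
      simp only [hpay]
      exact (continuousOn_const.mul (hu.1 i a)).add continuousOn_const)
    hWm ⟨sub_nonneg.2 hε.2.le, by linarith [hε.1]⟩ hν
  set S : I → Finset A := fun i => argmaxSet fun b => payM (u i) b (pertOf ε η τ) with hS
  have hμS : ∀ i, μ (S i) ∈ stdSimplex ℝ A ∧ ∀ a ∉ S i, μ (S i) a = 0 := fun i =>
    hμ _ (argmaxSet_nonempty _)
  have hμm : ∀ a, Measurable fun i => μ (S i) a := fun a =>
    measurable_comp_argmaxSet (fun b => hWm b τ hτ) fun T => μ T a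
  set h : I → A → ℝ := fun i a => (1 - ε) * μ (S i) a + ε * (1 / (Fintype.card A : ℝ)) with hh
  have hsoc : socSum lam h = τ := by
    funext a
    have hfi : Integrable (fun i => μ (S i) a) lam :=
      integrable_of_mem_stdSimplex (fun i => (hμS i).1) (hμm a)
    simp only [socSum, hh]
    rw [integral_add (hfi.const_mul _) (integrable_const _), integral_const_mul, hτeq a]
    simp [hS]
  have hprof : IsProfile lam h :=
    ⟨measurable_pi_lambda _ fun a => ((hμm a).const_mul _).add_const _, fun i =>
      convex_stdSimplex ℝ A (hμS i).1 hν (sub_nonneg.2 hε.2.le) hε.1.le (by ring)⟩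
  refine ⟨h, hprof, fun i i' hii => by simp only [hh, hS, hii], fun i => ?_, hprof, ?_,
    MeasurableSet.univ, ?_, isPerturbation_pertOf hε hη,
    fun τ' _ => ofReal_le_pertOf_singleton τ', fun i _ am al hlt => ?_⟩
  · rw [hsoc]
    exact ⟨μ (S i), (hμS i).1, fun μ' hμ' =>
      sum_mul_le_of_support_argmaxSet (hμS i).1 (hμS i).2 hμ', fun a => rfl⟩
  · refine ae_of_all _ fun i a => add_pos_of_nonneg_of_pos
      (mul_nonneg (sub_nonneg.2 hε.2.le) ((hμS i).1.1 a)) (mul_pos hε.1 (by positivity))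
  · rw [measure_univ, ENNReal.ofReal_lt_one]
    linarith [hε.1]
  · rw [hsoc] at hlt
    have ham : am ∉ S i := fun hmem => absurd (mem_argmaxSet.1 hmem al) (not_le.2 hlt)
    simp only [hh, (hμS i).2 am ham, mul_zero, zero_add]
    refine mul_le_of_le_one_right hε.1.le ((div_le_one hK).2 ?_)
    exact_mod_cast Fintype.card_pos
end

section
/- Let E be a finite set of edges and 𝒫 a finite nonempty set of paths, each path a nonempty subset of E; let Δ be the unit simplex of vectors (τ(p))_{p ∈ 𝒫} with nonnegative entries summing to 1, and for τ ∈ Δ and e ∈ E set τ(e) = Σ_{p ∈ 𝒫, e ∈ p} τ(p). Let ε ∈ (0, 1/|𝒫|), and for each e ∈ E let D_e : [0,1] → ℝ be continuous and monotone increasing. Suppose τ* minimizes Φ(τ) = Σ_{e ∈ E} ∫_0^{τ(e)} D_e(x) dx over the set {τ ∈ Δ : τ(p) ≥ ε for every p ∈ 𝒫}. Then (i) there exists p ∈ 𝒫 with τ*(p) > ε, and (ii) for every p ∈ 𝒫 with τ*(p) > ε and every p′ ∈ 𝒫, Σ_{e ∈ p} D_e(τ*(e)) ≤ Σ_{e ∈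 p′} D_e(τ*(e)); that is, every path carrying flow above ε has minimal perturbed cost. -/
open MeasureTheory Filter Topology

section Congestion

variable {E P : Type*} [Fintype E] [Fintype P] [DecidableEq E]

/-- The load of edge `e` under the path-flow `τ`. -/
def edgeLoad (edgeOf : P → Finset E) (τ : P → ℝ) (e : E) : ℝ :=
  ∑ p : P, if e ∈ edgeOf p then τ p else 0

/-- The cost of path `p` under the path-flow `τ`. -/
def pathCost (edgeOf : P → Finset E) (C : E → ℝ → ℝ) (p : P) (τ : P → ℝ) : ℝ :=
  ∑ e ∈ edgeOf p, C e (edgeLoad edgeOf τ e)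

/-- Nonnegative, continuous and monotone increasing edge cost functions on `[0,1]`. -/
def IsCongestionCost (C : E → ℝ → ℝ) : Prop :=
  ∀ e, ContinuousOn (C e) (Set.Icc (0:ℝ) 1) ∧ MonotoneOn (C e) (Set.Icc (0:ℝ) 1) ∧
    ∀ x ∈ Set.Icc (0:ℝ) 1, 0 ≤ C e x

/-- The common payoff of the congestion game: the negative of the path cost. -/
def congPayoff (I : Type*) (edgeOf : P → Finset E) (C : E → ℝ → ℝ) :
    I → P → (P → ℝ) → ℝ :=
  fun _ p τ => -(pathCost edgeOf C p τ)

/-- The uniform distribution on the simplex: the normalized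
`(card P - 1)`-dimensional Hausdorff measure restricted to the simplex. -/
noncomputable def unifSimplex (P : Type*) [Fintype P] : Measure (P → ℝ) :=
  (μH[(Fintype.card P : ℝ) - 1] (stdSimplex ℝ P))⁻¹ •
    (μH[(Fintype.card P : ℝ) - 1]).restrict (stdSimplex ℝ P)

end Congestion

lemma MonotoneOn.intervalIntegral_le_sub_mul {f : ℝ → ℝ} {s : Set ℝ} [hs : s.OrdConnected]
    (hf : MonotoneOn f s) {a b : ℝ} (ha : a ∈ s) (hb : b ∈ s) :
    ∫ x in a..b, f x ≤ (b - a) * f b := by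
  have hsub : Set.uIcc a b ⊆ s := hs.uIcc_subset ha hb
  have hint : IntervalIntegrable f volume a b := (hf.mono hsub).intervalIntegrable
  rcases le_total a b with hab | hab
  · have h := intervalIntegral.integral_mono_on hab hint
      (intervalIntegrable_const (c := f b)) fun x hx =>
        hf (hsub (Set.Icc_subset_uIcc hx)) hb hx.2
    simpa using h
  · have h := intervalIntegral.integral_mono_on hab
      (intervalIntegrable_const (c := f b)) hint.symm fun x hx =>
        hf hb (hsub (Set.Icc_subset_uIcc' hx)) hx.1
    rw [intervalIntegral.integral_symm]
    simp only [intervalIntegral.integral_const, smul_eq_mul] at h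
    linarith

/-- The path-flow obtained from `τ` by moving an amount `t` from path `p` to path `p'`. -/
def shiftFlow {P : Type*} [DecidableEq P] (τ : P → ℝ) (p p' : P) (t : ℝ) : P → ℝ :=
  τ + (Pi.single p' t - Pi.single p t)

lemma le_shiftFlow {P : Type*} [DecidableEq P] {τ : P → ℝ} {p : P} (p' : P) {ε t : ℝ}
    (hlb : ∀ q, ε ≤ τ q) (ht : 0 ≤ t) (htp : t ≤ τ p - ε) (q : P) :
    ε ≤ shiftFlow τ p p' t q := by
  have hq := hlb q
  simp only [shiftFlow, Pi.add_apply, Pi.sub_apply, Pi.single_apply]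
  split_ifs with h₁ h₂ h₂ <;> subst_vars <;> linarith

lemma sum_shiftFlow {P : Type*} [Fintype P] [DecidableEq P] (τ : P → ℝ) (p p' : P) (t : ℝ) :
    ∑ q, shiftFlow τ p p' t q = ∑ q, τ q := by
  simp [shiftFlow, Finset.sum_add_distrib, Finset.sum_sub_distrib]

section EdgeLoad

variable {E P : Type*} [Fintype P] [DecidableEq E] (edgeOf : P → Finset E)

lemma edgeLoad_mem_Icc {τ : P → ℝ} (hτ : τ ∈ stdSimplex ℝ P) (e : E) :
    edgeLoad edgeOf τ e ∈ Set.Icc (0 : ℝ) 1 := by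
  refine ⟨Finset.sum_nonneg fun p _ => ?_, ?_⟩
  · split_ifs
    exacts [hτ.1 p, le_rfl]
  · rw [← hτ.2]
    refine Finset.sum_le_sum fun p _ => ?_
    split_ifs
    exacts [le_rfl, hτ.1 p]

lemma edgeLoad_shiftFlow [DecidableEq P] (τ : P → ℝ) (p p' : P) (t : ℝ) (e : E) :
    edgeLoad edgeOf (shiftFlow τ p p' t) e = edgeLoad edgeOf τ e +
      t * ((if e ∈ edgeOf p' then 1 else 0) - if e ∈ edgeOf p then 1 else 0) := by
  simp only [edgeLoad, ← Finset.sum_filter]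
  simp only [shiftFlow, Pi.add_apply, Pi.sub_apply, Pi.single_apply, Finset.sum_add_distrib,
    Finset.sum_sub_distrib, Finset.sum_ite_eq', Finset.mem_filter, Finset.mem_univ, true_and]
  split_ifs <;> ring

end EdgeLoad

/-- KKT core of the optimization method: if `τ*` minimizes the
Beckmann-type potential `Φ(τ) = Σ_e ∫_0^{τ(e)} D_e(x) dx` over the flows in the
simplex with every coordinate at least `ε` (where `ε < 1/|𝒫|` and each `D_e` is
continuous and monotone increasing), then some path carries flow above `ε`, and
every path carrying flow above `ε` has minimal perturbed cost. -/
theorem statement9 {E P : Type*} [Fintype E] [Fintype P] [Nonempty P] [DecidableEq E]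
    (edgeOf : P → Finset E) (hedge : ∀ p, (edgeOf p).Nonempty)
    (D : E → ℝ → ℝ)
    (hcont : ∀ e, ContinuousOn (D e) (Set.Icc (0:ℝ) 1))
    (hmono : ∀ e, MonotoneOn (D e) (Set.Icc (0:ℝ) 1))
    (ε : ℝ) (hε : ε ∈ Set.Ioo (0:ℝ) (1 / (Fintype.card P : ℝ)))
    (τstar : P → ℝ) (hmem : τstar ∈ stdSimplex ℝ P) (hlb : ∀ p, ε ≤ τstar p)
    (hmin : ∀ τ ∈ stdSimplex ℝ P, (∀ p, ε ≤ τ p) →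
      (∑ e : E, ∫ x in (0:ℝ)..(edgeLoad edgeOf τstar e), D e x) ≤
        ∑ e : E, ∫ x in (0:ℝ)..(edgeLoad edgeOf τ e), D e x) :
    (∃ p : P, ε < τstar p) ∧
    ∀ p : P, ε < τstar p → ∀ p' : P,
      (∑ e ∈ edgeOf p, D e (edgeLoad edgeOf τstar e)) ≤
        ∑ e ∈ edgeOf p', D e (edgeLoad edgeOf τstar e) := by
  classical
  refine ⟨?_, fun p hp p' => ?_⟩
  · by_contra! h
    have hcard : (0 : ℝ) < Fintype.card P := by exact_mod_cast Fintype.card_pos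
    have hsum : ∑ q, τstar q ≤ Fintype.card P * ε := by
      simpa using Finset.sum_le_sum fun q (_ : q ∈ Finset.univ) => h q
    rw [hmem.2] at hsum
    have hlt := (lt_div_iff₀ hcard).mp hε.2
    linarith
  set c : E → ℝ := fun e => (if e ∈ edgeOf p' then 1 else 0) - if e ∈ edgeOf p then 1 else 0
    with hc
  set l : E → ℝ := edgeLoad edgeOf τstar with hl
  have hl_mem : ∀ e, l e ∈ Set.Icc (0 : ℝ) 1 := edgeLoad_mem_Icc edgeOf hmem
  have hshift : ∀ t ∈ Set.Ioc 0 (τstar p - ε),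
      (∀ e, l e + t * c e ∈ Set.Icc (0 : ℝ) 1) ∧ 0 ≤ ∑ e, c e * D e (l e + t * c e) := by
    intro t ht
    have hlb' := le_shiftFlow p' hlb ht.1.le ht.2
    have hmem' : shiftFlow τstar p p' t ∈ stdSimplex ℝ P :=
      ⟨fun q => hε.1.le.trans (hlb' q), (sum_shiftFlow τstar p p' t).trans hmem.2⟩
    have hload : ∀ e, edgeLoad edgeOf (shiftFlow τstar p p' t) e = l e + t * c e :=
      edgeLoad_shiftFlow edgeOf τstar p p' t
    have hl_mem' : ∀ e, l e + t * c e ∈ Set.Icc (0 : ℝ) 1 := fun e =>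
      hload e ▸ edgeLoad_mem_Icc edgeOf hmem' e
    refine ⟨hl_mem', ?_⟩
    have hΦ := hmin _ hmem' hlb'
    simp only [hload] at hΦ
    have hint : ∀ e, ∀ a ∈ Set.Icc (0 : ℝ) 1, IntervalIntegrable (D e) volume 0 a :=
      fun e a ha => ((hmono e).mono
        (Set.ordConnected_Icc.uIcc_subset (by simp) ha)).intervalIntegrable
    have hdiff : ∑ e, ((∫ x in (0:ℝ)..(l e + t * c e), D e x) - ∫ x in (0:ℝ)..(l e), D e x) ≤
        t * ∑ e, c e * D e (l e + t * c e) := by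
      rw [Finset.mul_sum]
      refine Finset.sum_le_sum fun e _ => ?_
      rw [intervalIntegral.integral_interval_sub_left (hint e _ (hl_mem' e))
        (hint e _ (hl_mem e))]
      refine ((hmono e).intervalIntegral_le_sub_mul (hl_mem e) (hl_mem' e)).trans_eq ?_
      ring
    rw [Finset.sum_sub_distrib] at hdiff
    exact nonneg_of_mul_nonneg_right ((sub_nonneg.mpr hΦ).trans hdiff) ht.1
  have hev : ∀ᶠ t in 𝓝[>] (0 : ℝ), t ∈ Set.Ioc 0 (τstar p - ε) :=
    Ioc_mem_nhdsGT (sub_pos.mpr hp)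
  have hlim : Tendsto (fun t => ∑ e, c e * D e (l e + t * c e)) (𝓝[>] 0)
      (𝓝 (∑ e, c e * D e (l e))) := by
    refine tendsto_finsetSum _ fun e _ => Tendsto.const_mul _ ?_
    refine (hcont e (l e) (hl_mem e)).tendsto.comp (tendsto_nhdsWithin_iff.mpr ⟨?_, ?_⟩)
    · have hcts : Continuous fun t : ℝ => l e + t * c e := by fun_prop
      simpa using (hcts.tendsto 0).mono_left nhdsWithin_le_nhds
    · filter_upwards [hev] with t ht using (hshift t ht).1 e
  have hnonneg := ge_of_tendsto hlim (hev.mono fun t ht => (hshift t ht).2)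
  simpa [hc, sub_mul, Finset.sum_sub_distrib, ← Finset.sum_filter] using hnonneg
end
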